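/- For every k >= 2 and every n > 18k² - 24k + 10, there is no uniquely C4+-saturated graph on n vertices with exactly k triangles. -/

import Mathlib

open SimpleGraph

/-- The diamond graph `C₄⁺`: a `4`-cycle with one chord, i.e. `K₄` minus an edge. -/
def diamond : SimpleGraph (Fin 4) := (⊤ : SimpleGraph (Fin 4)).deleteEdges {s(0, 1)}

/-- `G'` is a copy of `H` in `G`, i.e. a subgraph of `G` isomorphic to `H`. -/
def IsCopy {W V : Type*} (H : SimpleGraph W) {G : SimpleGraph V} (G' : G.Subgraph) : Prop :=
  Nonempty (G'.coe ≃g H)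

/-- `G` is uniquely `H`-saturated: `G` is `H`-free, and adding any non-edge
creates exactly one copy of `H`. -/
def UniquelySaturated {W V : Type*} (H : SimpleGraph W) (G : SimpleGraph V) : Prop :=
  (∀ G' : G.Subgraph, ¬ IsCopy H G') ∧
    ∀ u v : V, u ≠ v → ¬ G.Adj u v →
      ∃! G' : (G ⊔ SimpleGraph.fromEdgeSet {s(u, v)}).Subgraph, IsCopy H G'

/-- `p, q` are the tips and `x, y` the chord of a diamond in `H`. -/
def Dia {V : Type*} (H : SimpleGraph V) (p q x y : V) : Prop :=
  p ≠ q ∧ H.Adj x y ∧ H.Adj p x ∧ H.Adj p y ∧ H.Adj q x ∧ H.Adj q y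

theorem diamond_adj (i j : Fin 4) : diamond.Adj i j ↔ (i ≠ j ∧ s(i, j) ≠ s(0, 1)) := by
  simp [diamond]

theorem dia_of_copy {V : Type*} {H : SimpleGraph V} {G' : H.Subgraph} (h : IsCopy diamond G') :
    ∃ p q x y, Dia H p q x y := by
  obtain ⟨e⟩ := h
  have key : ∀ i j : Fin 4, diamond.Adj i j → H.Adj (e.symm i : V) (e.symm j : V) := by
    intro i j hij
    exact G'.hom.map_adj (e.symm.map_adj_iff.2 hij)
  refine ⟨e.symm 0, e.symm 1, e.symm 2, e.symm 3, ?_, key _ _ ?_, key _ _ ?_, key _ _ ?_,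
    key _ _ ?_, key _ _ ?_⟩
  · intro h
    have := e.symm.injective (Subtype.ext h)
    exact absurd this (by decide)
  all_goals rw [diamond_adj]; decide

/-- The copy of the diamond given by tips and chord. -/
def diaCopy {V : Type*} {H : SimpleGraph V} {p q x y : V} (h : Dia H p q x y) :
    SimpleGraph.Copy diamond H where
  toHom :=
    { toFun := ![p, q, x, y]
      map_rel' := by
        obtain ⟨h0, h1, h2, h3, h4, h5⟩ := h
        intro i j hij
        rw [diamond_adj] at hij
        fin_cases i <;> fin_cases j <;>
          simp_all [h1.symm, h2.symm, h3.symm, h4.symm, h5.symm] }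
  injective' := by
    obtain ⟨h0, h1, h2, h3, h4, h5⟩ := h
    intro i j hij
    have := h1.ne
    have := h2.ne
    have := h3.ne
    have := h4.ne
    have := h5.ne
    fin_cases i <;> fin_cases j <;> simp_all [eq_comm]

theorem dia_isCopy {V : Type*} {H : SimpleGraph V} {p q x y : V} (h : Dia H p q x y) :
    IsCopy diamond (diaCopy h).toSubgraph := ⟨(diaCopy h).isoToSubgraph.symm⟩

theorem dia_verts {V : Type*} {H : SimpleGraph V} {p q x y : V} (h : Dia H p q x y) (z : V) :
    z ∈ (diaCopy h).toSubgraph.verts ↔ z = p ∨ z = q ∨ z = x ∨ z = y := by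
  simp [SimpleGraph.Copy.toSubgraph, diaCopy, eq_comm]
  tauto

theorem dia_not_adj {V : Type*} {H : SimpleGraph V} {p q x y : V} (h : Dia H p q x y) (z w : V) :
    (diaCopy h).toSubgraph.Adj z w ↔ 
      (z ≠ w ∧ (z = p ∨ z = q ∨ z = x ∨ z = y) ∧ (w = p ∨ w = q ∨ w = x ∨ w = y) ∧ 
       s(z, w) ≠ s(p, q)) := by
  have h' := h
  obtain ⟨h0, h1, h2, h3, h4, h5⟩ := h'
  have := h1.ne
  have := h2.ne
  have := h3.ne
  have := h4.ne
  have := h5.ne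
  have e : (diaCopy h).toSubgraph.Adj z w ↔ ∃ i j, diamond.Adj i j ∧ 
     (![p,q,x,y] : Fin 4 → V) i = z ∧ (![p,q,x,y] : Fin 4 → V) j = w := by
    simp [SimpleGraph.Copy.toSubgraph, diaCopy, Relation.Map]
  rw [e]
  simp only [diamond_adj, Fin.exists_fin_succ]
  simp
  grind

theorem dia_tips {V : Type*} {H : SimpleGraph V} (hu : ∃! G' : H.Subgraph, IsCopy diamond G')
    {p q x y p' q' x' y' : V} (h : Dia H p q x y) (h' : Dia H p' q' x' y') :
    s(p, q) = s(p', q') := by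
  have e := hu.unique (dia_isCopy h) (dia_isCopy h')
  have e1 := dia_not_adj h p q
  have v1 := dia_verts h
  have e2 := dia_not_adj h' p q
  have v2 := dia_verts h'
  rw [← e] at e2 v2
  have := h.1
  have a1 := (v2 p).1 ((v1 p).2 (by simp))
  have a2 := (v2 q).1 ((v1 q).2 (by simp))
  by_contra hne
  exact (e1.1 (e2.2 ⟨this, a1, a2, hne⟩)).2.2.2 rfl

theorem add_adj {V : Type*} {G : SimpleGraph V} {u v : V} (huv : u ≠ v) (a b : V) :
    (G ⊔ SimpleGraph.fromEdgeSet {s(u, v)}).Adj a b ↔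
      G.Adj a b ∨ (a = u ∧ b = v) ∨ (a = v ∧ b = u) := by
  simp only [sup_adj, fromEdgeSet_adj, Set.mem_singleton_iff, Sym2.eq_iff]
  constructor
  · rintro (h | ⟨h, -⟩)
    · exact Or.inl h
    · exact Or.inr h
  · rintro (h | ⟨rfl, rfl⟩ | ⟨rfl, rfl⟩)
    · exact Or.inl h
    · exact Or.inr ⟨by simp, huv⟩
    · exact Or.inr ⟨by simp, huv.symm⟩

/-- diamond-freeness in elementary terms -/
theorem us_free {V : Type*} {G : SimpleGraph V} (h : UniquelySaturated diamond G)
    {p q x y : V} (hxy : G.Adj x y) (h1 : G.Adj p x) (h2 : G.Adj p y) (h3 : G.Adj q x)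
    (h4 : G.Adj q y) : p = q := by
  by_contra hne
  exact h.1 _ (dia_isCopy (H := G) (p := p) (q := q) (x := x) (y := y) ⟨hne, hxy, h1, h2, h3, h4⟩)

theorem us_ex {V : Type*} {G : SimpleGraph V} (h : UniquelySaturated diamond G)
    {u v : V} (huv : u ≠ v) (hn : ¬ G.Adj u v) :
    (∃ x y, x ≠ y ∧ G.Adj u x ∧ G.Adj u y ∧ G.Adj v x ∧ G.Adj v y) ∨
    (∃ x t, G.Adj u x ∧ G.Adj v x ∧ G.Adj t x ∧ G.Adj t u) ∨
    (∃ x t, G.Adj u x ∧ G.Adj v x ∧ G.Adj t x ∧ G.Adj t v) := by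
  obtain ⟨G', hG', -⟩ := h.2 u v huv hn
  obtain ⟨p, q, x, y, h0, h1, h2, h3, h4, h5⟩ := dia_of_copy hG'
  rw [add_adj huv] at h1 h2 h3 h4 h5
  have hf := fun (a : G.Adj x y) b c d e => h0 (us_free h (p := p) (q := q) a b c d e)
  have hs := G.symm
  have hl := G.loopless
  rcases h1 with h1 | ⟨rfl, rfl⟩ | ⟨rfl, rfl⟩
  · rcases h2 with h2 | ⟨rfl, rfl⟩ | ⟨rfl, rfl⟩
    · rcases h3 with h3 | ⟨rfl, rfl⟩ | ⟨rfl, rfl⟩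
      · rcases h4 with h4 | ⟨rfl, rfl⟩ | ⟨rfl, rfl⟩
        · rcases h5 with h5 | ⟨rfl, rfl⟩ | ⟨rfl, rfl⟩
          · exact (hf h1 h2 h3 h4 h5).elim
          · exact Or.inr (Or.inr ⟨x, p, h4, h1.symm, h2, h3⟩)
          · exact Or.inr (Or.inl ⟨x, p, h1.symm, h4, h2, h3⟩)
        · have h5 : G.Adj q y := by
            rcases h5 with h5 | ⟨_, rfl⟩ | ⟨rfl, _⟩
            · exact h5
            · exact absurd rfl h1.ne
            · exact absurd rfl huv
          exact Or.inr (Or.inr ⟨y, p, h5, h1, h3, h2⟩)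
        · have h5 : G.Adj q y := by
            rcases h5 with h5 | ⟨rfl, _⟩ | ⟨_, rfl⟩
            · exact h5
            · exact absurd rfl huv
            · exact absurd rfl h1.ne
          exact Or.inr (Or.inl ⟨y, p, h1, h5, h3, h2⟩)
      · have h4 : G.Adj q x := by
          rcases h4 with h4 | ⟨rfl, _⟩ | ⟨rfl, rfl⟩
          · exact h4
          · exact absurd rfl h0
          · exact absurd rfl h2.ne
        have h5 : G.Adj q y := by
          rcases h5 with h5 | ⟨rfl, _⟩ | ⟨rfl, rfl⟩
          · exact h5
          · exact absurd rfl h0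
          · exact absurd rfl huv
        exact Or.inr (Or.inr ⟨x, q, h2, h1.symm, h4, h5⟩)
      · have h4 : G.Adj q x := by
          rcases h4 with h4 | ⟨rfl, rfl⟩ | ⟨rfl, _⟩
          · exact h4
          · exact absurd rfl h2.ne
          · exact absurd rfl h0
        have h5 : G.Adj q y := by
          rcases h5 with h5 | ⟨rfl, rfl⟩ | ⟨rfl, _⟩
          · exact h5
          · exact absurd rfl huv
          · exact absurd rfl h0
        exact Or.inr (Or.inl ⟨x, q, h1.symm, h2, h4, h5⟩)
    · have h3 : G.Adj p y := by
        rcases h3 with h3 | ⟨_, rfl⟩ | ⟨rfl, _⟩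
        · exact h3
        · exact absurd rfl h1.ne
        · exact absurd rfl huv
      have h4 : G.Adj q x := by
        rcases h4 with h4 | ⟨rfl, _⟩ | ⟨rfl, rfl⟩
        · exact h4
        · exact absurd rfl h0
        · exact absurd rfl huv
      have h5 : G.Adj q y := by
        rcases h5 with h5 | ⟨rfl, _⟩ | ⟨rfl, rfl⟩
        · exact h5
        · exact absurd rfl h0
        · exact absurd rfl (‹G.Adj y y›).ne
      exact Or.inr (Or.inr ⟨y, q, h3, h1, h5, h4⟩)
    · have h3 : G.Adj p y := by
        rcases h3 with h3 | ⟨rfl, _⟩ | ⟨_, rfl⟩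
        · exact h3
        · exact absurd rfl huv
        · exact absurd rfl h1.ne
      have h4 : G.Adj q x := by
        rcases h4 with h4 | ⟨rfl, rfl⟩ | ⟨rfl, _⟩
        · exact h4
        · exact absurd rfl huv
        · exact absurd rfl h0
      have h5 : G.Adj q y := by
        rcases h5 with h5 | ⟨rfl, rfl⟩ | ⟨rfl, _⟩
        · exact h5
        · exact absurd rfl (‹G.Adj y y›).ne
        · exact absurd rfl h0
      exact Or.inr (Or.inl ⟨y, q, h1, h3, h5, h4⟩)
  · left
    refine ⟨p, q, h0, ?_⟩
    clear hf
    grind [SimpleGraph.adj_comm, SimpleGraph.irrefl]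
  · left
    refine ⟨p, q, h0, ?_⟩
    clear hf
    grind [SimpleGraph.adj_comm, SimpleGraph.irrefl]

/-- two common neighbours exclude a triangle through `u x` -/
theorem us_two {V : Type*} {G : SimpleGraph V} (h : UniquelySaturated diamond G)
    {u v x y t : V} (huv : u ≠ v) (hn : ¬ G.Adj u v) (hxy : x ≠ y) (h1 : G.Adj u x)
    (h2 : G.Adj u y) (h3 : G.Adj v x) (h4 : G.Adj v y) (h5 : G.Adj t u) (h6 : G.Adj t x) :
    False := by
  have hA := add_adj (G := G) huv
  have e := dia_tips (h.2 u v huv hn) (p := x) (q := y) (x := u) (y := v)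
    (p' := v) (q' := t) (x' := u) (y' := x)
    (by simp [Dia, hA, hxy, h1.symm, h2.symm, h3.symm, h4.symm])
    (by
      simp only [Dia, hA]
      refine ⟨?_, Or.inl h1, ?_, Or.inl h3, Or.inl h5, Or.inl h6⟩
      · rintro rfl
        exact hn h5.symm
      · simp)
  simp only [Sym2.eq_iff] at e
  rcases e with ⟨e1, -⟩ | ⟨-, e1⟩
  · exact h3.ne e1.symm
  · exact h4.ne e1.symm

/-- at most two common neighbours -/
theorem us_three {V : Type*} {G : SimpleGraph V} (h : UniquelySaturated diamond G)
    {u v x y z : V} (huv : u ≠ v) (hn : ¬ G.Adj u v) (hxy : x ≠ y) (hxz : x ≠ z) (hyz : y ≠ z)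
    (h1 : G.Adj u x) (h2 : G.Adj u y) (h3 : G.Adj v x) (h4 : G.Adj v y) (h5 : G.Adj u z)
    (h6 : G.Adj v z) : False := by
  have hA := add_adj (G := G) huv
  have e := dia_tips (h.2 u v huv hn) (p := x) (q := y) (x := u) (y := v)
    (p' := x) (q' := z) (x' := u) (y' := v)
    (by simp [Dia, hA, hxy, h1.symm, h2.symm, h3.symm, h4.symm])
    (by simp [Dia, hA, hxz, h1.symm, h5.symm, h3.symm, h6.symm])
  simp only [Sym2.eq_iff] at e
  grind

/-- triangles sharing a vertex are equal -/
theorem us_tri {V : Type*} {G : SimpleGraph V} (h : UniquelySaturated diamond G)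
    {a b c d e : V} (h1 : G.Adj a b) (h2 : G.Adj a c) (h3 : G.Adj b c)
    (h4 : G.Adj a d) (h5 : G.Adj a e) (h6 : G.Adj d e) : d = b ∨ d = c := by
  by_contra hne
  push Not at hne
  have hA := add_adj (G := G) hne.1.symm
  by_cases hbd : G.Adj b d
  · exact hne.2 (us_free h (p := d) (q := c) h1 h4.symm hbd.symm h2.symm h3.symm)
  have e := dia_tips (h.2 b d hne.1.symm hbd) (p := c) (q := d) (x := a) (y := b)
    (p' := b) (q' := e) (x' := a) (y' := d)
    (by simp [Dia, hA, hne.2.symm, h1, h2.symm, h3.symm, h4.symm])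
    (by
      simp only [Dia, hA]
      refine ⟨?_, Or.inl h4, Or.inl h1.symm, by simp, Or.inl h5.symm, Or.inl h6.symm⟩
      rintro rfl
      exact hbd h6.symm)
  simp only [Sym2.eq_iff] at e
  rcases e with ⟨e1, -⟩ | ⟨-, e1⟩
  · exact h3.ne e1.symm
  · exact hne.1 e1

open Classical in
/-- neighbourhood -/
noncomputable def Nb {V : Type*} [Fintype V] (G : SimpleGraph V) (v : V) : Finset V :=
  Finset.univ.filter (fun x => G.Adj v x)

open Classical in
/-- weight of a pair: 2 for an edge in a triangle, 1 for another edge, 0 for a non-edge -/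
noncomputable def wt {V : Type*} (G : SimpleGraph V) (x y : V) : ℕ :=
  if G.Adj x y then (if ∃ t, G.Adj t x ∧ G.Adj t y then 2 else 1) else 0

theorem mem_Nb {V : Type*} [Fintype V] {G : SimpleGraph V} {v x : V} :
    x ∈ Nb G v ↔ G.Adj v x := by simp [Nb]

theorem wt_comm {V : Type*} (G : SimpleGraph V) (x y : V) : wt G x y = wt G y x := by
  have e1 : G.Adj x y = G.Adj y x := propext (G.adj_comm x y)
  have e2 : (∃ t, G.Adj t x ∧ G.Adj t y) = (∃ t, G.Adj t y ∧ G.Adj t x) :=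
    propext (exists_congr fun t => and_comm)
  unfold wt
  congr 1
  congr 1

theorem wt_zero {V : Type*} {G : SimpleGraph V} {x y : V} (h : ¬ G.Adj x y) : wt G x y = 0 := by
  simp [wt, h]

theorem wt_one {V : Type*} {G : SimpleGraph V} {x y : V} (h : G.Adj x y)
    (h' : ∀ t, G.Adj t x → G.Adj t y → False) : wt G x y = 1 := by
  have : ¬ ∃ t, G.Adj t x ∧ G.Adj t y := fun ⟨t, h1, h2⟩ => h' t h1 h2
  simp only [wt, if_pos h, if_neg this]

theorem wt_two {V : Type*} {G : SimpleGraph V} {x y t : V} (h : G.Adj x y)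
    (h1 : G.Adj t x) (h2 : G.Adj t y) : wt G x y = 2 := by
  have : ∃ t, G.Adj t x ∧ G.Adj t y := ⟨t, h1, h2⟩
  simp only [wt, if_pos h, if_pos this]

theorem wt_sum {V : Type*} [Fintype V] {G : SimpleGraph V} (h : UniquelySaturated diamond G)
    {u v : V} (huv : u ≠ v) (hn : ¬ G.Adj u v)
    (hv : ∀ x t, G.Adj u x → G.Adj v x → G.Adj t x → G.Adj t v → False) :
    ∑ x ∈ Nb G v, wt G u x = 2 := by
  classical
  rcases us_ex h huv hn with ⟨x, y, hxy, h1, h2, h3, h4⟩ | ⟨x, t, h1, h2, h3, h4⟩ |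
    ⟨x, t, h1, h2, h3, h4⟩
  · have e : ∑ z ∈ ({x, y} : Finset V), wt G u z = ∑ z ∈ Nb G v, wt G u z := by
      apply Finset.sum_subset
      · intro z hz
        simp only [Finset.mem_insert, Finset.mem_singleton] at hz
        rw [mem_Nb]
        rcases hz with rfl | rfl <;> assumption
      · intro z hz hz'
        simp only [Finset.mem_insert, Finset.mem_singleton, not_or] at hz'
        rw [mem_Nb] at hz
        apply wt_zero
        intro huz
        exact us_three h huv hn hxy (Ne.symm hz'.1) (Ne.symm hz'.2) h1 h2 h3 h4 huz hz
    rw [← e, Finset.sum_pair hxy, wt_one h1, wt_one h2]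
    · intro t ht ht'
      exact us_two h huv hn hxy.symm h2 h1 h4 h3 ht ht'
    · intro t ht ht'
      exact us_two h huv hn hxy h1 h2 h3 h4 ht ht'
  · rw [Finset.sum_eq_single x]
    · exact wt_two h1 h4 h3
    · intro y hy hyx
      rw [mem_Nb] at hy
      apply wt_zero
      intro huy
      exact us_two h huv hn hyx.symm h1 huy h2 hy h4 h3
    · intro hx
      exact absurd (mem_Nb.2 h2) hx
  · exact (hv x t h1 h2 h3 h4).elim

theorem key {V : Type*} [Fintype V] {G : SimpleGraph V} (h : UniquelySaturated diamond G)
    {a b c v : V} (hab : G.Adj a b) (hac : G.Adj a c) (hbc : G.Adj b c) (hav : G.Adj a v)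
    (hv : ∀ y z, G.Adj v y → G.Adj v z → ¬ G.Adj y z) :
    (Nb G a).card = (Nb G b).card + 1 := by
  classical
  have hvb : ¬ G.Adj v b := fun e => hv _ _ hav.symm e hab
  have hvc : ¬ G.Adj v c := fun e => hv _ _ hav.symm e hac
  have vb : v ≠ b := fun e => hv a c hav.symm (e ▸ hbc) hac
  have vc : v ≠ c := fun e => hv a b hav.symm (e ▸ hbc.symm) hab
  obtain ⟨X, hX⟩ : ∃ X, X = (Nb G v).erase a := ⟨_, rfl⟩
  obtain ⟨B, hB⟩ : ∃ B, B = ((Nb G b).erase a).erase c := ⟨_, rfl⟩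
  obtain ⟨A, hA⟩ : ∃ A, A = (((Nb G a).erase v).erase b).erase c := ⟨_, rfl⟩
  have mX : ∀ x, x ∈ X ↔ x ≠ a ∧ G.Adj v x := by simp [hX, mem_Nb]
  have mB : ∀ x, x ∈ B ↔ x ≠ c ∧ x ≠ a ∧ G.Adj b x := by simp [hB, mem_Nb]
  have mA : ∀ x, x ∈ A ↔ x ≠ c ∧ x ≠ b ∧ x ≠ v ∧ G.Adj a x := by simp [hA, mem_Nb]
  have Xa : ∀ x ∈ X, ¬ G.Adj x a := fun x hx => hv _ _ ((mX x).1 hx).2 hav.symm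
  have Xb : ∀ x ∈ X, ¬ G.Adj x b := fun x hx e =>
    us_two h (u := b) (v := v) (x := a) (y := x) (t := c) vb.symm (fun e => hvb e.symm)
      ((mX x).1 hx).1.symm hab.symm e.symm hav.symm ((mX x).1 hx).2 hbc.symm hac.symm
  have Xc : ∀ x ∈ X, ¬ G.Adj x c := fun x hx e =>
    us_two h (u := c) (v := v) (x := a) (y := x) (t := b) vc.symm (fun e => hvc e.symm)
      ((mX x).1 hx).1.symm hac.symm e.symm hav.symm ((mX x).1 hx).2 hbc hab.symm
  have xb : ∀ x ∈ X, x ≠ b := fun x hx e => hvb (e ▸ ((mX x).1 hx).2)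
  have s1 : ∀ x ∈ X, ∑ w ∈ B, wt G x w = 2 := by
    intro x hx
    rw [← wt_sum h (xb x hx) (Xb x hx)]
    · apply Finset.sum_subset
      · intro w hw
        exact mem_Nb.2 ((mB w).1 hw).2.2
      · intro w hw hw'
        have := mem_Nb.1 hw
        by_cases e : w = c
        · exact wt_zero (e ▸ Xc x hx)
        by_cases e' : w = a
        · exact wt_zero (e' ▸ Xa x hx)
        exact absurd ((mB w).2 ⟨e, e', this⟩) hw'
    · intro w t h1 h2 h3 h4
      rcases us_tri h hab.symm hbc hac h2 h4.symm h3.symm with rfl | rfl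
      · exact Xa x hx h1
      · exact Xc x hx h1
  have s2 : ∀ w ∈ B, ∑ x ∈ X, wt G x w = 2 := by
    intro w hw
    obtain ⟨w1, w2, w3⟩ := (mB w).1 hw
    have vw : ¬ G.Adj v w := fun e => Xb w ((mX w).2 ⟨w2, e⟩) w3.symm
    have wv : w ≠ v := fun e => hvb (e ▸ w3.symm)
    rw [← wt_sum h wv (fun e => vw e.symm) (fun x t _ h2 h3 h4 => hv _ _ h2 h4.symm h3.symm)]
    rw [Finset.sum_congr rfl (fun x _ => wt_comm G x w)]
    apply Finset.sum_subset
    · intro x hx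
      exact mem_Nb.2 ((mX x).1 hx).2
    · intro x hx hx'
      have hxa : x = a := by
        by_contra e
        exact hx' ((mX x).2 ⟨e, mem_Nb.1 hx⟩)
      subst hxa
      apply wt_zero
      intro e
      rcases us_tri h hab.symm hbc hac w3 hab.symm e with rfl | rfl
      · exact w2 rfl
      · exact w1 rfl
  have s3 : ∀ x ∈ X, ∑ w ∈ A, wt G x w = 1 := by
    intro x hx
    have hs := wt_sum h (u := x) (v := a) ((mX x).1 hx).1 (Xa x hx) (by
      intro w t h1 h2 h3 h4
      rcases us_tri h hab hac hbc h2 h4.symm h3.symm with rfl | rfl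
      · exact Xb x hx h1
      · exact Xc x hx h1)
    rw [← Finset.add_sum_erase _ _ (mem_Nb.2 hav), wt_one ((mX x).1 hx).2.symm
      (fun t h1 h2 => hv _ _ ((mX x).1 hx).2 h2.symm h1.symm)] at hs
    have : ∑ w ∈ A, wt G x w = ∑ w ∈ (Nb G a).erase v, wt G x w := by
      apply Finset.sum_subset
      · intro w hw
        obtain ⟨w1, w2, w3, w4⟩ := (mA w).1 hw
        exact Finset.mem_erase.2 ⟨w3, mem_Nb.2 w4⟩
      · intro w hw hw'
        obtain ⟨w1, w2⟩ := Finset.mem_erase.1 hw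
        by_cases e : w = c
        · exact wt_zero (e ▸ Xc x hx)
        by_cases e' : w = b
        · exact wt_zero (e' ▸ Xb x hx)
        exact absurd ((mA w).2 ⟨e, e', w1, mem_Nb.1 w2⟩) hw'
    omega
  have s4 : ∀ w ∈ A, ∑ x ∈ X, wt G x w = 1 := by
    intro w hw
    obtain ⟨w1, w2, w3, w4⟩ := (mA w).1 hw
    have vw : ¬ G.Adj v w := fun e => hv _ _ hav.symm e w4
    have hs := wt_sum h w3 (fun e => vw e.symm)
      (fun x t _ h2 h3 h4 => hv _ _ h2 h4.symm h3.symm)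
    rw [← Finset.add_sum_erase _ _ (mem_Nb.2 hav.symm), ← hX, wt_one w4.symm (by
      intro t h1 h2
      rcases us_tri h hab hac hbc w4 h2.symm h1.symm with rfl | rfl
      · exact w2 rfl
      · exact w1 rfl)] at hs
    have e : ∑ x ∈ X, wt G x w = ∑ x ∈ X, wt G w x :=
      Finset.sum_congr rfl (fun x _ => wt_comm G x w)
    omega
  have c1 := Finset.sum_comm (s := X) (t := B) (f := fun x w => wt G x w)
  rw [Finset.sum_congr rfl s1, Finset.sum_congr rfl s2] at c1
  have c2 := Finset.sum_comm (s := X) (t := A) (f := fun x w => wt G x w)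
  rw [Finset.sum_congr rfl s3, Finset.sum_congr rfl s4] at c2
  simp only [Finset.sum_const, smul_eq_mul] at c1 c2
  have k1 : B.card + 2 = (Nb G b).card := by
    have i1 : a ∈ Nb G b := mem_Nb.2 hab.symm
    have i2 : c ∈ (Nb G b).erase a := Finset.mem_erase.2 ⟨hac.ne.symm, mem_Nb.2 hbc⟩
    rw [← Finset.card_erase_add_one i1, ← Finset.card_erase_add_one i2, hB]
  have k2 : A.card + 3 = (Nb G a).card := by
    have i1 : v ∈ Nb G a := mem_Nb.2 hav
    have i2 : b ∈ (Nb G a).erase v := Finset.mem_erase.2 ⟨vb.symm, mem_Nb.2 hab⟩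
    have i3 : c ∈ ((Nb G a).erase v).erase b :=
      Finset.mem_erase.2 ⟨hbc.ne.symm, Finset.mem_erase.2 ⟨vc.symm, mem_Nb.2 hac⟩⟩
    rw [← Finset.card_erase_add_one i1, ← Finset.card_erase_add_one i2,
      ← Finset.card_erase_add_one i3, hA]
  omega

/-- vertices in triangles -/
def Red {V : Type*} (G : SimpleGraph V) (v : V) : Prop :=
  ∃ y z, G.Adj v y ∧ G.Adj v z ∧ G.Adj y z

theorem not_red {V : Type*} {G : SimpleGraph V} {v : V} (h : ¬ Red G v) :
    ∀ y z, G.Adj v y → G.Adj v z → ¬ G.Adj y z := fun y z h1 h2 h3 => h ⟨y, z, h1, h2, h3⟩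

open Classical in
/-- set of vertices in triangles -/
noncomputable def RR {V : Type*} [Fintype V] (G : SimpleGraph V) : Finset V :=
  Finset.univ.filter (fun x => Red G x)

theorem mem_RR {V : Type*} [Fintype V] {G : SimpleGraph V} {x : V} :
    x ∈ RR G ↔ Red G x := by simp [RR]

theorem bound {V : Type*} [Fintype V] {G : SimpleGraph V} (h : UniquelySaturated diamond G)
    {a b c : V} (hab : G.Adj a b) (hac : G.Adj a c) (hbc : G.Adj b c)
    (hb : ∀ w, G.Adj b w → Red G w) (hc : ∀ w, G.Adj c w → Red G w) :
    Fintype.card V ≤ 2 * (RR G).card + ((RR G).card - 1).choose 2 := by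
  classical
  have rb : Red G b := hc b hbc.symm
  have ra : Red G a := hb a hab.symm
  have nb : (Nb G b).card ≤ (RR G).card - 1 := by
    rw [← Finset.card_erase_of_mem (mem_RR.2 rb)]
    apply Finset.card_le_card
    intro w hw
    rw [mem_Nb] at hw
    exact Finset.mem_erase.2 ⟨hw.ne.symm, mem_RR.2 (hb w hw)⟩
  have pos : 0 < (RR G).card := Finset.card_pos.2 ⟨b, mem_RR.2 rb⟩
  have na : (Nb G a).card ≤ (RR G).card := by
    by_cases hr : ∀ w, G.Adj a w → Red G w
    · apply Finset.card_le_card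
      intro w hw
      exact mem_RR.2 (hr w (mem_Nb.1 hw))
    · push Not at hr
      obtain ⟨v, h1, h2⟩ := hr
      have := key h hab hac hbc h1 (not_red h2)
      omega
  obtain ⟨B, hB⟩ : ∃ B : Finset V, B = Finset.univ.filter
    (fun x => ¬ Red G x ∧ ¬ G.Adj a x) := ⟨_, rfl⟩
  have mB : ∀ x, x ∈ B ↔ ¬ Red G x ∧ ¬ G.Adj a x := by simp [hB]
  have two : ∀ x ∈ B, ∃ p q, p ≠ q ∧ G.Adj b p ∧ G.Adj b q ∧ G.Adj x p ∧ G.Adj x q := by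
    intro x hx
    obtain ⟨h1, h2⟩ := (mB x).1 hx
    have h3 : ¬ G.Adj b x := fun e => h1 (hb x e)
    have h4 : ¬ G.Adj c x := fun e => h1 (hc x e)
    have h5 : b ≠ x := fun e => h1 (e ▸ rb)
    rcases us_ex h h5 h3 with ⟨p, q, h⟩ | ⟨p, t, g1, g2, g3, g4⟩ | ⟨p, t, g1, g2, g3, g4⟩
    · exact ⟨p, q, h⟩
    · rcases us_tri h hab.symm hbc hac g1 g4.symm g3.symm with rfl | rfl
      · exact (h2 g2.symm).elim
      · exact (h4 g2.symm).elim
    · exact (h1 ⟨p, t, g2, g4.symm, g3.symm⟩).elim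
  have cB : B.card ≤ ((RR G).card - 1).choose 2 := by
    refine le_trans ?_ (Nat.choose_le_choose 2 nb)
    rw [← Finset.card_powersetCard]
    apply Finset.card_le_card_of_injOn (fun x => (Nb G b) ∩ (Nb G x))
    · intro x hx
      obtain ⟨p, q, g0, g1, g2, g3, g4⟩ := two x hx
      obtain ⟨h1, h2⟩ := (mB x).1 hx
      have h3 : ¬ G.Adj b x := fun e => h1 (hb x e)
      have h5 : b ≠ x := fun e => h1 (e ▸ rb)
      have : Nb G b ∩ Nb G x = {p, q} := by
        ext z
        simp only [Finset.mem_inter, mem_Nb, Finset.mem_insert, Finset.mem_singleton]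
        constructor
        · rintro ⟨z1, z2⟩
          by_contra hz
          push Not at hz
          exact us_three h h5 h3 g0 hz.1.symm hz.2.symm g1 g2 g3 g4 z1 z2
        · rintro (rfl | rfl)
          · exact ⟨g1, g3⟩
          · exact ⟨g2, g4⟩
      simp only [Finset.mem_coe, Finset.mem_powersetCard]
      refine ⟨Finset.inter_subset_left, ?_⟩
      rw [this, Finset.card_pair g0]
    · intro x hx y hy hxy
      obtain ⟨p, q, g0, g1, g2, g3, g4⟩ := two x hx
      obtain ⟨h1, -⟩ := (mB x).1 hx
      obtain ⟨h1', -⟩ := (mB y).1 hy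
      have hxy' : Nb G b ∩ Nb G x = Nb G b ∩ Nb G y := hxy
      have e : ∀ z, G.Adj b z → G.Adj x z → G.Adj y z := by
        intro z z1 z2
        have : z ∈ Nb G b ∩ Nb G x := Finset.mem_inter.2 ⟨mem_Nb.2 z1, mem_Nb.2 z2⟩
        rw [hxy'] at this
        exact mem_Nb.1 (Finset.mem_inter.1 this).2
      by_contra hne
      exact us_three h (u := p) (v := q) (x := b) (y := x) (z := y) g0
        (not_red h1 _ _ g3 g4) (fun e => h1 (e ▸ rb)) (fun e => h1' (e ▸ rb)) hne
        g1.symm g3.symm g2.symm g4.symm (e p g1 g3).symm (e q g2 g4).symm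
  have cov : (Finset.univ : Finset V) ⊆ (RR G ∪ Nb G a) ∪ B := by
    intro x _
    simp only [Finset.mem_union, mem_RR, mem_Nb, mB]
    tauto
  have c1 := Finset.card_le_card cov
  have c2 := Finset.card_union_le (RR G ∪ Nb G a) B
  have c3 := Finset.card_union_le (RR G) (Nb G a)
  rw [Finset.card_univ] at c1
  omega

theorem red_card {V : Type*} [Fintype V] (G : SimpleGraph V) :
    (RR G).card ≤ (G.cliqueSet 3).ncard * 3 := by
  classical
  have : (G.cliqueSet 3).ncard = (G.cliqueFinset 3).card := by
    rw [← Set.ncard_coe_finset, coe_cliqueFinset]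
  rw [this]
  refine le_trans (Finset.card_le_card (t := (G.cliqueFinset 3).biUnion id) ?_)
    (Finset.card_biUnion_le_card_mul _ _ _ ?_)
  · intro x hx
    obtain ⟨y, z, h1, h2, h3⟩ := mem_RR.1 hx
    rw [Finset.mem_biUnion]
    refine ⟨{x, y, z}, ?_, by simp⟩
    rw [mem_cliqueFinset_iff, is3Clique_triple_iff]
    exact ⟨h1, h2, h3⟩
  · intro s hs
    rw [mem_cliqueFinset_iff] at hs
    exact hs.card_eq.le

theorem stmt11 {V : Type*} [Fintype V] (G : SimpleGraph V) (k : ℕ) (hk : 2 ≤ k)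
    (hn : Fintype.card V > 18 * k ^ 2 - 24 * k + 10)
    (hcount : (G.cliqueSet 3).ncard = k) :
    ¬ UniquelySaturated diamond G := by
  intro h
  classical
  have hR := red_card G
  rw [hcount] at hR
  have hne : (G.cliqueSet 3).Nonempty := by
    rw [Set.nonempty_iff_ne_empty]
    intro e
    rw [e, Set.ncard_empty] at hcount
    omega
  obtain ⟨s, hs⟩ := hne
  rw [mem_cliqueSet_iff, is3Clique_iff] at hs
  obtain ⟨a, b, c, hab, hac, hbc, -⟩ := hs
  have hb : Fintype.card V ≤ 2 * (RR G).card + ((RR G).card - 1).choose 2 := by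
    by_cases ha : ∀ w, G.Adj a w → Red G w
    · by_cases hb : ∀ w, G.Adj b w → Red G w
      · exact bound h hac.symm hbc.symm hab ha hb
      · by_cases hc : ∀ w, G.Adj c w → Red G w
        · exact bound h hab.symm hbc hac ha hc
        · push Not at hb hc
          obtain ⟨v, v1, v2⟩ := hb
          obtain ⟨w, w1, w2⟩ := hc
          have e1 := key h hbc hab.symm hac.symm v1 (not_red v2)
          have e2 := key h hbc.symm hac.symm hab.symm w1 (not_red w2)
          omega
    · push Not at ha
      obtain ⟨u, u1, u2⟩ := ha
      refine bound h hab hac hbc ?_ ?_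
      · by_contra hb
        push Not at hb
        obtain ⟨v, v1, v2⟩ := hb
        have e1 := key h hab hac hbc u1 (not_red u2)
        have e2 := key h hab.symm hbc hac v1 (not_red v2)
        omega
      · by_contra hb
        push Not at hb
        obtain ⟨v, v1, v2⟩ := hb
        have e1 := key h hac hab hbc.symm u1 (not_red u2)
        have e2 := key h hac.symm hbc.symm hab v1 (not_red v2)
        omega
  have hc : ((RR G).card - 1).choose 2 ≤ (3 * k - 1).choose 2 :=
    Nat.choose_le_choose 2 (by omega)
  obtain ⟨j, rfl⟩ : ∃ j, k = j + 2 := ⟨k - 2, by omega⟩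
  have e : (3 * (j + 2) - 1).choose 2 * 2 ≤ (3 * j + 5) * (3 * j + 4) := by
    have : 3 * (j + 2) - 1 = 3 * j + 5 := by omega
    rw [this, Nat.choose_two_right]
    exact Nat.div_mul_le_self _ _
  have e3 : 18 * (j + 2) ^ 2 - 24 * (j + 2) = 18 * j ^ 2 + 48 * j + 24 := by
    apply Nat.sub_eq_of_eq_add
    ring
  rw [e3] at hn
  nlinarith
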